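/- arXiv:1402.4560 — 2 statements merged into one kernel-verified Lean document; each statement's English description precedes it below -/
import Mathlib

section
/- Maximum-principle rigidity for the transport equation on the half-plane. Let 𝒟 = {(R,Z) ∈ ℝ² : R ≤ 0}, let c ≠ 0 and γ be real numbers, and let U, Ψ : 𝒟 → ℝ be C¹ up to the boundary. Suppose that on 𝒟: c U + γ Y·∇U + ∇^⊥Ψ·∇U = 0, that ∂_Z Ψ(0,Z) = 0 for every Z ∈ ℝ, and that U(Y) → 0 as |Y| → ∞, Y ∈ 𝒟. Then U ≡ 0 on 𝒟. -/
/-- Partial derivative in the first variable. -/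
noncomputable def pd1 (f : ℝ → ℝ → ℝ) (x y : ℝ) : ℝ := deriv (fun s => f s y) x

/-- Partial derivative in the second variable. -/
noncomputable def pd2 (f : ℝ → ℝ → ℝ) (x y : ℝ) : ℝ := deriv (fun s => f x s) y

/-- **Maximum-principle rigidity for the transport equation on the half-plane.**
On `𝒟 = {(R,Z) : R ≤ 0}`, with `c ≠ 0`, `U, Ψ` of class `C¹` up to the boundary, if
`c U + γ Y·∇U + ∇^⊥Ψ·∇U = 0` on `𝒟`, `∂_Z Ψ(0,Z) = 0` for all `Z`, and `U(Y) → 0` as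
`|Y| → ∞` in `𝒟`, then `U ≡ 0` on `𝒟`. -/
theorem transport_maximum_principle_halfplane
    (c γ : ℝ) (hc : c ≠ 0)
    (U Ψ : ℝ → ℝ → ℝ)
    (hU : ContDiffOn ℝ 1 (fun q : ℝ × ℝ => U q.1 q.2) {q : ℝ × ℝ | q.1 ≤ 0})
    (hΨ : ContDiffOn ℝ 1 (fun q : ℝ × ℝ => Ψ q.1 q.2) {q : ℝ × ℝ | q.1 ≤ 0})
    (hpde : ∀ R ≤ (0 : ℝ), ∀ Z : ℝ,
      c * U R Z + γ * (R * pd1 U R Z + Z * pd2 U R Z)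
        + (-(pd2 Ψ R Z) * pd1 U R Z + pd1 Ψ R Z * pd2 U R Z) = 0)
    (hbc : ∀ Z : ℝ, pd2 Ψ 0 Z = 0)
    (hdecay : ∀ ε > 0, ∃ M : ℝ, ∀ R ≤ (0 : ℝ), ∀ Z : ℝ,
      M < Real.sqrt (R ^ 2 + Z ^ 2) → |U R Z| < ε) :
    ∀ R ≤ (0 : ℝ), ∀ Z : ℝ, U R Z = 0 := by
  intro R0 hR0 Z0
  by_contra hne
  obtain ⟨M, hM⟩ := hdecay |U R0 Z0| (abs_pos.mpr hne)
  have hbox : ∀ R ≤ (0 : ℝ), ∀ Z : ℝ, |U R0 Z0| ≤ |U R Z| →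
      (R, Z) ∈ Set.Icc (-M) 0 ×ˢ Set.Icc (-M) M := by
    intro R hR Z h
    have h1 : Real.sqrt (R ^ 2 + Z ^ 2) ≤ M := by
      by_contra hlt
      exact absurd (hM R hR Z (not_le.mp hlt)) (not_lt.mpr h)
    have h2 : |R| ≤ M := (Real.abs_le_sqrt (by nlinarith [sq_nonneg Z])).trans h1
    have h3 : |Z| ≤ M := (Real.abs_le_sqrt (by nlinarith [sq_nonneg R])).trans h1
    exact ⟨⟨(abs_le.mp h2).1, hR⟩, abs_le.mp h3⟩
  have hcomp : IsCompact (Set.Icc (-M) (0:ℝ) ×ˢ Set.Icc (-M) M) :=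
    isCompact_Icc.prod isCompact_Icc
  have hcont : ContinuousOn (fun q : ℝ × ℝ => |U q.1 q.2|)
      (Set.Icc (-M) (0:ℝ) ×ˢ Set.Icc (-M) M) :=
    (hU.continuousOn.mono (fun q hq => hq.1.2)).abs
  obtain ⟨⟨R, Z⟩, hq, hmax⟩ := hcomp.exists_isMaxOn ⟨_, hbox R0 hR0 Z0 le_rfl⟩ hcont
  have hR : R ≤ 0 := hq.1.2
  have h0 : |U R0 Z0| ≤ |U R Z| := hmax (hbox R0 hR0 Z0 le_rfl)
  have hglob : ∀ R' ≤ (0 : ℝ), ∀ Z' : ℝ, |U R' Z'| ≤ |U R Z| := by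
    intro R' hR' Z'
    rcases le_total |U R0 Z0| |U R' Z'| with h | h
    · exact hmax (hbox R' hR' Z' h)
    · exact h.trans h0
  have hext : ∀ (f : ℝ → ℝ) (a : ℝ), (∀ᶠ x in nhds a, |f x| ≤ |f a|) → deriv f a = 0 := by
    intro f a h
    rcases le_total 0 (f a) with ha | ha
    · have : IsLocalMax f a := by
        filter_upwards [h] with x hx
        rw [abs_of_nonneg ha] at hx
        exact (le_abs_self _).trans hx
      exact this.deriv_eq_zero
    · have : IsLocalMin f a := by
        filter_upwards [h] with x hx
        rw [abs_of_nonpos ha] at hx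
        linarith [neg_abs_le (f x)]
      exact this.deriv_eq_zero
  have hd2 : pd2 U R Z = 0 :=
    hext (fun s => U R s) Z (Filter.Eventually.of_forall fun s => hglob R hR s)
  have hUne : U R Z ≠ 0 := abs_pos.mp ((abs_pos.mpr hne).trans_le h0)
  have hp := hpde R hR Z
  rcases hR.lt_or_eq with hlt | heq
  · have hd1 : pd1 U R Z = 0 := by
      refine hext (fun s => U s Z) R ?_
      filter_upwards [Iio_mem_nhds hlt] with s hs
      exact hglob s (le_of_lt hs) Z
    rw [hd1, hd2] at hp
    exact mul_ne_zero hc hUne (by linarith)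
  · subst heq
    rw [hd2, hbc Z] at hp
    exact mul_ne_zero hc hUne (by linarith)
end

section
/- Liouville theorem for sublinear harmonic functions on a half-plane vanishing on the boundary. Let 𝒟 = {(R,Z) ∈ ℝ² : R ≤ 0}. Suppose h : 𝒟 → ℝ is continuous on 𝒟, harmonic on the interior {R < 0} (i.e. ∂_R²h + ∂_Z²h = 0 there), satisfies h(0,Z) = 0 for every Z ∈ ℝ, and |h(Y)|/|Y| → 0 as |Y| → ∞, Y ∈ 𝒟. Then h ≡ 0 on 𝒟. -/
lemma aux_second_deriv (f : ℝ → ℝ) (x a b c : ℝ) (hf : ContDiffAt ℝ 2 f x)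
    (hm : IsLocalMax (fun s => f s - (a * s ^ 2 + b * s + c)) x) :
    deriv (deriv f) x ≤ 2 * a := by
  by_contra hcon
  push Not at hcon
  have hev : ∀ᶠ y in nhds x, DifferentiableAt ℝ f y := by
    filter_upwards [hf.eventually (by simp)] with y hy
    exact hy.differentiableAt (by norm_num)
  have hq : ∀ y : ℝ, HasDerivAt (fun s : ℝ => a * s ^ 2 + b * s + c) (2 * a * y + b) y := by
    intro y
    have := (((hasDerivAt_pow 2 y).const_mul a).add ((hasDerivAt_id y).const_mul b)).add_const c
    refine this.congr_deriv ?_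
    norm_num
    ring
  have hd1 : deriv (fun s => f s - (a * s ^ 2 + b * s + c)) =ᶠ[nhds x]
      fun y => deriv f y - (2 * a * y + b) := by
    filter_upwards [hev] with y hy
    exact (hy.hasDerivAt.sub (hq y)).deriv
  have hdd : DifferentiableAt ℝ (deriv f) x := by
    have h1 : ContDiffAt ℝ 1 (deriv f) x := by
      exact ContDiffAt.derivWithin hf (by norm_num)
    exact h1.differentiableAt (by norm_num)
  have hd2 : deriv (deriv (fun s => f s - (a * s ^ 2 + b * s + c))) x
      = deriv (deriv f) x - 2 * a := by
    rw [hd1.deriv_eq]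
    have := hdd.hasDerivAt.sub ((((hasDerivAt_id x).const_mul (2 * a))).add_const b)
    rw [mul_one] at this
    exact this.deriv
  have hmin := isLocalMin_of_deriv_deriv_pos (f := fun s => f s - (a * s ^ 2 + b * s + c))
    (x₀ := x) (by rw [hd2]; linarith) hm.deriv_eq_zero
    (hf.continuousAt.sub (hq x).continuousAt)
  have hconst : (fun s => f s - (a * s ^ 2 + b * s + c)) =ᶠ[nhds x]
      fun _ => f x - (a * x ^ 2 + b * x + c) := by
    filter_upwards [hm, hmin] with y h1 h2
    exact le_antisymm h1 h2
  have h3 : deriv (deriv (fun s => f s - (a * s ^ 2 + b * s + c))) x = 0 := by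
    rw [hconst.deriv.deriv_eq]
    simp
  rw [hd2] at h3
  linarith

lemma aux_upper
    (h : ℝ → ℝ → ℝ)
    (hcont : ContinuousOn (fun q : ℝ × ℝ => h q.1 q.2) {q : ℝ × ℝ | q.1 ≤ 0})
    (hsmooth : ContDiffOn ℝ 2 (fun q : ℝ × ℝ => h q.1 q.2) {q : ℝ × ℝ | q.1 < 0})
    (hharm : ∀ R < (0 : ℝ), ∀ Z : ℝ, pd1 (pd1 h) R Z + pd2 (pd2 h) R Z = 0)
    (hbc : ∀ Z : ℝ, h 0 Z = 0) (ε ρ : ℝ) (hε : 0 < ε) (hρ : 0 < ρ)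
    (harc : ∀ R ≤ (0 : ℝ), ∀ Z : ℝ, R ^ 2 + Z ^ 2 = ρ ^ 2 → h R Z ≤ ε * ρ)
    (R Z : ℝ) (hR : R ≤ 0) (hRZ : R ^ 2 + Z ^ 2 ≤ ρ ^ 2) :
    h R Z ≤ ε * ((Z ^ 2 - 2 * R ^ 2) / ρ - 3 * R) := by
  set v : ℝ × ℝ → ℝ := fun q => h q.1 q.2 - ε * ((q.2 ^ 2 - 2 * q.1 ^ 2) / ρ - 3 * q.1) with hv
  set K : Set (ℝ × ℝ) := {q | q.1 ≤ 0 ∧ q.1 ^ 2 + q.2 ^ 2 ≤ ρ ^ 2} with hK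
  have hKc : IsCompact K := by
    apply (isCompact_Icc (a := ((-ρ, -ρ) : ℝ × ℝ)) (b := (ρ, ρ))).of_isClosed_subset
    · exact IsClosed.and (isClosed_le continuous_fst continuous_const)
        (isClosed_le (f := fun q : ℝ × ℝ => q.1 ^ 2 + q.2 ^ 2) (by fun_prop) continuous_const)
    · rintro ⟨r, z⟩ ⟨h1, h2⟩
      simp only at h1 h2
      have hr := abs_le_of_sq_le_sq' (a := r) (b := ρ) (by nlinarith [sq_nonneg z]) hρ.le
      have hz := abs_le_of_sq_le_sq' (a := z) (b := ρ) (by nlinarith [sq_nonneg r]) hρ.le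
      exact ⟨⟨hr.1, hz.1⟩, ⟨hr.2, hz.2⟩⟩
  have hvc : ContinuousOn v K := by
    apply ContinuousOn.sub (hcont.mono fun q hq => hq.1)
    fun_prop
  obtain ⟨⟨r, z⟩, ⟨hr, hrz⟩, hmax⟩ := hKc.exists_isMaxOn ⟨(R, Z), hR, hRZ⟩ hvc
  simp only at hr hrz
  have hle : v (R, Z) ≤ v (r, z) := hmax (show (R, Z) ∈ K from ⟨hR, hRZ⟩)
  suffices v (r, z) ≤ 0 by
    have := hle.trans this
    simp only [hv] at this
    linarith
  rcases hr.eq_or_lt with rfl | hr0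
  · simp only [hv, hbc]
    have : 0 ≤ ε * (z ^ 2 / ρ) := by positivity
    simpa using this
  rcases hrz.eq_or_lt with harc' | hint
  · have h1 := harc r hr z harc'
    have hrρ : -ρ ≤ r := (abs_le_of_sq_le_sq' (by nlinarith [sq_nonneg z]) hρ.le).1
    have h2 : ρ ≤ (z ^ 2 - 2 * r ^ 2) / ρ - 3 * r := by
      rw [le_sub_iff_add_le, le_div_iff₀ hρ]
      nlinarith
    have := mul_le_mul_of_nonneg_left h2 hε.le
    simp only [hv]
    linarith
  · exfalso
    have hKn : K ∈ nhds (r, z) := by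
      have ho : IsOpen {q : ℝ × ℝ | q.1 < 0 ∧ q.1 ^ 2 + q.2 ^ 2 < ρ ^ 2} :=
        IsOpen.and (isOpen_lt continuous_fst continuous_const)
          (isOpen_lt (f := fun q : ℝ × ℝ => q.1 ^ 2 + q.2 ^ 2) (by fun_prop) continuous_const)
      exact Filter.mem_of_superset (ho.mem_nhds ⟨hr0, hint⟩) fun q hq => ⟨hq.1.le, hq.2.le⟩
    have hlm : IsLocalMax v (r, z) := hmax.isLocalMax hKn
    have hC : ContDiffAt ℝ 2 (fun q : ℝ × ℝ => h q.1 q.2) (r, z) :=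
      hsmooth.contDiffAt ((isOpen_lt continuous_fst continuous_const).mem_nhds hr0)
    have e1 : pd1 (pd1 h) r z ≤ 2 * (-2 * ε / ρ) := by
      apply aux_second_deriv (fun s => h s z) r (-2 * ε / ρ) (-3 * ε) (ε * z ^ 2 / ρ)
      · exact hC.comp r (f := fun s : ℝ => (s, z)) (by fun_prop)
      · have hl : IsLocalMax (v ∘ fun s : ℝ => (s, z)) r :=
          IsLocalMax.comp_continuous (g := fun s : ℝ => (s, z)) (b := r) hlm (by fun_prop)
        convert hl using 2
        simp only [hv, Function.comp]
        ring
    have e2 : pd2 (pd2 h) r z ≤ 2 * (ε / ρ) := by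
      apply aux_second_deriv (fun s => h r s) z (ε / ρ) 0 (ε * (- 2 * r ^ 2 / ρ - 3 * r))
      · exact hC.comp z (f := fun s : ℝ => (r, s)) (by fun_prop)
      · have hl : IsLocalMax (v ∘ fun s : ℝ => (r, s)) z :=
          IsLocalMax.comp_continuous (g := fun s : ℝ => (r, s)) (b := z) hlm (by fun_prop)
        convert hl using 2
        simp only [hv, Function.comp]
        ring
    have := hharm r hr0 z
    have hp : 0 < ε / ρ := by positivity
    have : 2 * (-2 * ε / ρ) = -4 * (ε / ρ) := by ring
    linarith

lemma aux_nonpos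
    (h : ℝ → ℝ → ℝ)
    (hcont : ContinuousOn (fun q : ℝ × ℝ => h q.1 q.2) {q : ℝ × ℝ | q.1 ≤ 0})
    (hsmooth : ContDiffOn ℝ 2 (fun q : ℝ × ℝ => h q.1 q.2) {q : ℝ × ℝ | q.1 < 0})
    (hharm : ∀ R < (0 : ℝ), ∀ Z : ℝ, pd1 (pd1 h) R Z + pd2 (pd2 h) R Z = 0)
    (hbc : ∀ Z : ℝ, h 0 Z = 0)
    (hsub : ∀ ε > 0, ∃ M : ℝ, ∀ R ≤ (0 : ℝ), ∀ Z : ℝ,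
      M < Real.sqrt (R ^ 2 + Z ^ 2) → |h R Z| ≤ ε * Real.sqrt (R ^ 2 + Z ^ 2))
    (R : ℝ) (hR : R ≤ 0) (Z : ℝ) : h R Z ≤ 0 := by
  by_contra hpos
  push Not at hpos
  set ε := h R Z / (2 * (1 - 3 * R)) with hεd
  have hε : 0 < ε := div_pos hpos (by linarith)
  obtain ⟨M, hM⟩ := hsub ε hε
  set ρ := |M| + 1 + (R ^ 2 + Z ^ 2) with hρd
  have hρ1 : 1 ≤ ρ := by linarith [abs_nonneg M, sq_nonneg R, sq_nonneg Z]
  have hρ2 : R ^ 2 + Z ^ 2 ≤ ρ := by linarith [abs_nonneg M]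
  have hρM : M < ρ := by linarith [le_abs_self M, sq_nonneg R, sq_nonneg Z]
  have key := aux_upper h hcont hsmooth hharm hbc ε ρ hε (by linarith) (by
    intro r hr z hrz
    have hs : Real.sqrt (r ^ 2 + z ^ 2) = ρ := by
      rw [hrz]; exact Real.sqrt_sq (by linarith)
    have := hM r hr z (by rw [hs]; exact hρM)
    rw [hs] at this
    exact (le_abs_self _).trans this) R Z hR (by nlinarith)
  have h1 : (Z ^ 2 - 2 * R ^ 2) / ρ ≤ 1 := by
    rw [div_le_one (by linarith)]
    nlinarith [sq_nonneg R]
  have h2 : h R Z ≤ ε * (1 - 3 * R) :=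
    key.trans (mul_le_mul_of_nonneg_left (by linarith) hε.le)
  have h3 : ε * (1 - 3 * R) = h R Z / 2 := by
    rw [hεd]
    have : (1 - 3 * R) ≠ 0 := (by linarith : 0 < 1 - 3 * R).ne'
    field_simp
  linarith


/-- **Liouville theorem for sublinear harmonic functions on a half-plane vanishing on
the boundary.**  If `h` is continuous on the closed left half-plane
`𝒟 = {(R,Z) : R ≤ 0}`, harmonic on the interior `{R < 0}` (it is `C²` there and
`∂_R²h + ∂_Z²h = 0`), vanishes on the boundary `R = 0`, and `|h(Y)|/|Y| → 0` as
`|Y| → ∞` in `𝒟`, then `h ≡ 0` on `𝒟`. -/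
theorem liouville_sublinear_harmonic_halfplane
    (h : ℝ → ℝ → ℝ)
    (hcont : ContinuousOn (fun q : ℝ × ℝ => h q.1 q.2) {q : ℝ × ℝ | q.1 ≤ 0})
    (hsmooth : ContDiffOn ℝ 2 (fun q : ℝ × ℝ => h q.1 q.2) {q : ℝ × ℝ | q.1 < 0})
    (hharm : ∀ R < (0 : ℝ), ∀ Z : ℝ, pd1 (pd1 h) R Z + pd2 (pd2 h) R Z = 0)
    (hbc : ∀ Z : ℝ, h 0 Z = 0)
    (hsub : ∀ ε > 0, ∃ M : ℝ, ∀ R ≤ (0 : ℝ), ∀ Z : ℝ,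
      M < Real.sqrt (R ^ 2 + Z ^ 2) → |h R Z| ≤ ε * Real.sqrt (R ^ 2 + Z ^ 2)) :
    ∀ R ≤ (0 : ℝ), ∀ Z : ℝ, h R Z = 0 := by
  intro R hR Z
  apply le_antisymm (aux_nonpos h hcont hsmooth hharm hbc hsub R hR Z)
  have := aux_nonpos (fun r z => - h r z) hcont.neg hsmooth.neg (by
    intro r hr z
    have e := hharm r hr z
    have e1 : pd1 (pd1 fun r z => - h r z) r z = - pd1 (pd1 h) r z := by
      simp [pd1, deriv.fun_neg']
    have e2 : pd2 (pd2 fun r z => - h r z) r z = - pd2 (pd2 h) r z := by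
      simp [pd2, deriv.fun_neg']
    rw [e1, e2]
    linarith) (by simp [hbc]) (by simpa only [abs_neg] using hsub) R hR Z
  linarith
end
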